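/- arXiv:2007.05857 — 2 statements merged into one kernel-verified Lean document; each statement's English description precedes it below -/
import Mathlib

section
/- Let f : {-1,1}^n → {-1,1} be monotone, let P_π be the product measure on {-1,1}^n with probabilities p_1,…,p_n ∈ (0,1), and suppose the first-order Fourier coefficients are all equal: f̂^π({i}) = f̂^π({j}) for all i, j. Then for every coordinate i, the influence is bounded by I_i^π(f) ≤ sd^π(f) / (σ_i √n), where sd^π(f) = √(Var_π(f(X))). -/
/-- Encode a Boolean coordinate as an element of {-1, 1} ⊆ ℝ. -/
noncomputable def toR (b : Bool) : ℝ := if b then 1 else -1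

/-- Weight of a point `x ∈ {-1,1}ⁿ` under the product measure with `P(Xᵢ = 1) = pᵢ`. -/
noncomputable def wPi (n : ℕ) (p : Fin n → ℝ) (x : Fin n → Bool) : ℝ :=
  ∏ i, (if x i then p i else 1 - p i)

/-- Expectation under the product measure `P_π` on `{-1,1}ⁿ`. -/
noncomputable def piE (n : ℕ) (p : Fin n → ℝ) (f : (Fin n → Bool) → ℝ) : ℝ :=
  ∑ x : Fin n → Bool, wPi n p x * f x

/-- The mean `μᵢ = 2pᵢ - 1` of coordinate `i`. -/
noncomputable def mu (n : ℕ) (p : Fin n → ℝ) (i : Fin n) : ℝ := 2 * p i - 1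

/-- The standard deviation `σᵢ = √(1 - μᵢ²)` of coordinate `i`. -/
noncomputable def sigma (n : ℕ) (p : Fin n → ℝ) (i : Fin n) : ℝ :=
  Real.sqrt (1 - mu n p i ^ 2)

/-- The standardised coordinate `φ(xᵢ) = (xᵢ - μᵢ)/σᵢ`. -/
noncomputable def phi (n : ℕ) (p : Fin n → ℝ) (i : Fin n) (x : Fin n → Bool) : ℝ :=
  (toR (x i) - mu n p i) / sigma n p i

/-- The p-biased basis function `φ_S(x) = ∏_{i∈S} φ(xᵢ)` (with `φ_∅ = 1`). -/
noncomputable def phiS (n : ℕ) (p : Fin n → ℝ) (S : Finset (Fin n)) (x : Fin n → Bool) : ℝ :=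
  ∏ i ∈ S, phi n p i x

/-- The p-biased Fourier coefficient `f̂^π(S) = E_π[f(X) φ_S(X)]`. -/
noncomputable def fourierPi (n : ℕ) (p : Fin n → ℝ) (f : (Fin n → Bool) → ℝ)
    (S : Finset (Fin n)) : ℝ :=
  piE n p (fun x => f x * phiS n p S x)

/-- The discrete derivative `Dᵢf(x) = ½(f(x^{(i,1)}) - f(x^{(i,-1)}))`. -/
noncomputable def Dder (n : ℕ) (f : (Fin n → Bool) → ℝ) (i : Fin n) (x : Fin n → Bool) : ℝ :=
  (f (Function.update x i true) - f (Function.update x i false)) / 2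

theorem wPi_nonneg {n : ℕ} {p : Fin n → ℝ} (hp : ∀ i, p i ∈ Set.Ioo (0 : ℝ) 1)
    (x : Fin n → Bool) : 0 ≤ wPi n p x := by
  refine Finset.prod_nonneg fun i _ => ?_
  have h := hp i
  split_ifs <;> linarith [h.1, h.2]

theorem wPi_update {n : ℕ} (p : Fin n → ℝ) (i : Fin n) (x : Fin n → Bool) (b : Bool) :
    wPi n p (Function.update x i b) =
      (if b then p i else 1 - p i) *
        ∏ j ∈ Finset.univ.erase i, (if x j then p j else 1 - p j) := by
  rw [wPi, ← Finset.mul_prod_erase _ _ (Finset.mem_univ i), Function.update_self]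
  congr 1
  refine Finset.prod_congr rfl fun j hj => ?_
  rw [Function.update_of_ne (Finset.ne_of_mem_erase hj)]

theorem piE_add {n : ℕ} (p : Fin n → ℝ) (f g : (Fin n → Bool) → ℝ) :
    piE n p (fun x => f x + g x) = piE n p f + piE n p g := by
  simp only [piE, mul_add, Finset.sum_add_distrib]

theorem piE_sub {n : ℕ} (p : Fin n → ℝ) (f g : (Fin n → Bool) → ℝ) :
    piE n p (fun x => f x - g x) = piE n p f - piE n p g := by
  simp only [piE, mul_sub, Finset.sum_sub_distrib]

theorem piE_const_mul {n : ℕ} (p : Fin n → ℝ) (c : ℝ) (f : (Fin n → Bool) → ℝ) :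
    piE n p (fun x => c * f x) = c * piE n p f := by
  simp only [piE, Finset.mul_sum]
  exact Finset.sum_congr rfl fun x _ => by ring

theorem piE_sum {n : ℕ} {ι : Type*} (s : Finset ι) (p : Fin n → ℝ)
    (f : ι → (Fin n → Bool) → ℝ) :
    piE n p (fun x => ∑ j ∈ s, f j x) = ∑ j ∈ s, piE n p (f j) := by
  simp only [piE, Finset.mul_sum]
  exact Finset.sum_comm

theorem piE_one {n : ℕ} (p : Fin n → ℝ) : piE n p (fun _ => 1) = 1 := by
  have h := Finset.prod_univ_sum (fun _ : Fin n => (Finset.univ : Finset Bool))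
    (fun i b => if b then p i else 1 - p i)
  simp only [Fintype.piFinset_univ] at h
  simp only [piE, wPi, mul_one, ← h]
  simp

theorem piE_const {n : ℕ} (p : Fin n → ℝ) (c : ℝ) : piE n p (fun _ => c) = c := by
  simpa [piE_one] using piE_const_mul p c (fun _ => 1)

theorem piE_nonneg {n : ℕ} {p : Fin n → ℝ} (hp : ∀ i, p i ∈ Set.Ioo (0 : ℝ) 1)
    {f : (Fin n → Bool) → ℝ} (hf : ∀ x, 0 ≤ f x) : 0 ≤ piE n p f :=
  Finset.sum_nonneg fun x _ => mul_nonneg (wPi_nonneg hp x) (hf x)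

/-- Resampling coordinate `i` does not change the expectation. -/
theorem piE_resample {n : ℕ} (p : Fin n → ℝ) (i : Fin n) (f : (Fin n → Bool) → ℝ) :
    piE n p f = piE n p (fun x =>
      p i * f (Function.update x i true) + (1 - p i) * f (Function.update x i false)) := by
  have hinv : Function.Involutive
      (fun x : Fin n → Bool => Function.update x i (!x i)) := fun x => by simp
  have sum_flip (G : (Fin n → Bool) → ℝ) :
      2 * ∑ x, G x = ∑ x, (G x + G (Function.update x i (!x i))) := by
    rw [Finset.sum_add_distrib, two_mul]
    congr 1
    exact (Equiv.sum_comp hinv.toPerm G).symm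
  refine mul_left_cancel₀ (two_ne_zero (α := ℝ)) ?_
  simp only [piE]
  rw [sum_flip, sum_flip]
  refine Finset.sum_congr rfl fun x _ => ?_
  have hx : x = Function.update x i (x i) := (Function.update_eq_self i x).symm
  generalize x i = b at hx
  rw [hx]
  cases b <;> simp [wPi_update] <;> ring

theorem sigma_sq {n : ℕ} {p : Fin n → ℝ} (hp : ∀ i, p i ∈ Set.Ioo (0 : ℝ) 1) (i : Fin n) :
    sigma n p i ^ 2 = 4 * p i * (1 - p i) := by
  have h := hp i
  have h0 := mul_pos h.1 (sub_pos.2 h.2)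
  rw [sigma, Real.sq_sqrt] <;> simp only [mu] <;> nlinarith

theorem sigma_pos {n : ℕ} {p : Fin n → ℝ} (hp : ∀ i, p i ∈ Set.Ioo (0 : ℝ) 1) (i : Fin n) :
    0 < sigma n p i := by
  have h := hp i
  have h0 := mul_pos h.1 (sub_pos.2 h.2)
  refine Real.sqrt_pos.2 ?_
  simp only [mu]
  nlinarith

/-- Integration by parts against the standardised coordinate `φ(xᵢ)`. -/
theorem piE_mul_phi {n : ℕ} {p : Fin n → ℝ} (hp : ∀ i, p i ∈ Set.Ioo (0 : ℝ) 1) (i : Fin n)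
    (f : (Fin n → Bool) → ℝ) :
    piE n p (fun x => f x * phi n p i x) = sigma n p i * piE n p (Dder n f i) := by
  rw [piE_resample p i, ← piE_const_mul]
  congr 1
  funext x
  have h0 := (sigma_pos hp i).ne'
  have h2 := sigma_sq hp i
  simp only [phi, Dder, Function.update_self, toR, mu, if_true, Bool.false_eq_true, if_false]
  field_simp
  rw [h2]
  ring

theorem piE_phi {n : ℕ} {p : Fin n → ℝ} (hp : ∀ i, p i ∈ Set.Ioo (0 : ℝ) 1) (i : Fin n) :
    piE n p (phi n p i) = 0 := by
  have h := piE_mul_phi hp i (fun _ => 1)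
  have hD : Dder n (fun _ => 1) i = fun _ => 0 := by funext x; simp [Dder]
  rw [hD, piE_const] at h
  simpa using h

theorem piE_phi_mul_phi {n : ℕ} {p : Fin n → ℝ} (hp : ∀ i, p i ∈ Set.Ioo (0 : ℝ) 1)
    (i j : Fin n) :
    piE n p (fun x => phi n p i x * phi n p j x) = if i = j then 1 else 0 := by
  rw [piE_mul_phi hp]
  split_ifs with hij
  · subst hij
    have h0 := (sigma_pos hp i).ne'
    have hD : Dder n (phi n p i) i = fun _ => (sigma n p i)⁻¹ := by
      funext x
      simp only [Dder, phi, Function.update_self, toR, if_true, Bool.false_eq_true, if_false]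
      field_simp
      ring
    rw [hD, piE_const, mul_inv_cancel₀ h0]
  · have hD : Dder n (phi n p i) j = fun _ => 0 := by
      funext x
      simp [Dder, phi, Function.update_of_ne hij]
    rw [hD, piE_const, mul_zero]

/-- Bessel's inequality at level one. -/
theorem sum_fourierPi_singleton_sq_le {n : ℕ} {p : Fin n → ℝ}
    (hp : ∀ i, p i ∈ Set.Ioo (0 : ℝ) 1) (f : (Fin n → Bool) → ℝ) :
    ∑ j, fourierPi n p f {j} ^ 2 ≤ piE n p (fun x => (f x - piE n p f) ^ 2) := by
  set m := piE n p f
  set c : Fin n → ℝ := fun j => fourierPi n p f {j}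
  have hc (j : Fin n) : piE n p (fun x => (f x - m) * phi n p j x) = c j := by
    simp only [sub_mul, piE_sub, piE_const_mul, piE_phi hp, mul_zero, sub_zero]
    simp [c, fourierPi, phiS]
  have hcross : piE n p (fun x => (f x - m) * ∑ j, c j * phi n p j x) = ∑ j, c j ^ 2 := by
    simp only [Finset.mul_sum, mul_left_comm _ (c _), piE_sum, piE_const_mul, hc, sq]
  have hsq : piE n p (fun x => (∑ j, c j * phi n p j x) ^ 2) = ∑ j, c j ^ 2 := by
    have hpt : (fun x => (∑ j, c j * phi n p j x) ^ 2) = fun x =>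
        ∑ i, ∑ j, c i * c j * (phi n p i x * phi n p j x) := by
      funext x
      rw [sq, Finset.sum_mul_sum]
      simp only [mul_mul_mul_comm]
    rw [hpt]
    simp only [piE_sum, piE_const_mul, piE_phi_mul_phi hp]
    simp [sq]
  have key := piE_nonneg hp (fun x => sq_nonneg ((f x - m) - ∑ j, c j * phi n p j x))
  have hexp : piE n p (fun x => ((f x - m) - ∑ j, c j * phi n p j x) ^ 2) =
      piE n p (fun x => (f x - m) ^ 2) - ∑ j, c j ^ 2 := by
    have hpt : (fun x => ((f x - m) - ∑ j, c j * phi n p j x) ^ 2) = fun x =>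
        (f x - m) ^ 2 - 2 * ((f x - m) * ∑ j, c j * phi n p j x) +
          (∑ j, c j * phi n p j x) ^ 2 := by
      funext x; ring
    rw [hpt, piE_add, piE_sub, piE_const_mul, hcross, hsq]
    ring
  linarith

theorem Dder_sq_of_monotone {n : ℕ} {f : (Fin n → Bool) → ℝ} (hf : ∀ x, f x = 1 ∨ f x = -1)
    (hmono : ∀ x y : Fin n → Bool, (∀ i, toR (x i) ≤ toR (y i)) → f x ≤ f y)
    (i : Fin n) (x : Fin n → Bool) : Dder n f i x ^ 2 = Dder n f i x := by
  have hle : f (Function.update x i false) ≤ f (Function.update x i true) := by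
    refine hmono _ _ fun j => ?_
    rcases eq_or_ne j i with rfl | hj
    · norm_num [toR]
    · simp [Function.update_of_ne hj]
  rw [Dder]
  rcases hf (Function.update x i true) with h1 | h1 <;>
    rcases hf (Function.update x i false) with h2 | h2 <;>
    rw [h1, h2] at hle ⊢ <;> linarith

/-- For a monotone Boolean function `f : {-1,1}ⁿ → {-1,1}` whose first-order Fourier
coefficients are all equal, the influence of each coordinate is bounded by
`I_i^π(f) ≤ sd^π(f) / (σᵢ √n)`, where `sd^π(f) = √(Var_π(f))`. -/
theorem influence_bound (n : ℕ) (p : Fin n → ℝ) (hp : ∀ i, p i ∈ Set.Ioo (0 : ℝ) 1)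
    (f : (Fin n → Bool) → ℝ) (hf : ∀ x, f x = 1 ∨ f x = -1)
    (hmono : ∀ x y : Fin n → Bool, (∀ i, toR (x i) ≤ toR (y i)) → f x ≤ f y)
    (heq : ∀ i j : Fin n, fourierPi n p f {i} = fourierPi n p f {j}) (i : Fin n) :
    piE n p (fun x => Dder n f i x ^ 2) ≤
      Real.sqrt (piE n p (fun x => (f x - piE n p f) ^ 2)) /
        (sigma n p i * Real.sqrt n) := by
  have hσ := sigma_pos hp i
  have hn : (0 : ℝ) < n := Nat.cast_pos.2 i.pos
  have hI : fourierPi n p f {i} = sigma n p i * piE n p (fun x => Dder n f i x ^ 2) := by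
    simp only [Dder_sq_of_monotone hf hmono]
    rw [← piE_mul_phi hp]
    simp [fourierPi, phiS]
  have hB := sum_fourierPi_singleton_sq_le hp f
  simp only [fun j => heq j i, Finset.sum_const, Finset.card_univ, Fintype.card_fin,
    nsmul_eq_mul] at hB
  rw [le_div_iff₀ (mul_pos hσ (Real.sqrt_pos.2 hn))]
  refine Real.le_sqrt_of_sq_le (le_trans (le_of_eq ?_) hB)
  rw [hI, mul_pow, mul_pow, Real.sq_sqrt hn.le]
  ring
end

section
/- Let f : {-1,1}^n → {-1,1}, let P_π be the product measure on {-1,1}^n with probabilities p_1,…,p_n ∈ (0,1), fix ρ ∈ (−1,1), and let Y be the noisy copy of X in which independently each coordinate satisfies Y_i = X_i with probability ½(1+ρ) and Y_i = −X_i with probability ½(1−ρ). Then Cov_{π,ρ}(f(X), f(Y)) = Σ_{S≠∅} ω(S) ρ^{|S|} f̂^π(S) f̂^{π,ρ}(S), where ω(S) = ∏_{i∈S} σ_i/σ_i^ρ. -/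
/-- Weight of the noisy copy `y` given `x`: independently each coordinate satisfies
`yᵢ = xᵢ` with probability `(1+ρ)/2` and `yᵢ = -xᵢ` with probability `(1-ρ)/2`. -/
noncomputable def wNoise (n : ℕ) (ρ : ℝ) (x y : Fin n → Bool) : ℝ :=
  ∏ i, (if y i = x i then (1 + ρ) / 2 else (1 - ρ) / 2)

/-- Joint expectation `E_{π,ρ}`: first over the noise given `X`, then over `X ~ P_π`. -/
noncomputable def jointE (n : ℕ) (p : Fin n → ℝ) (ρ : ℝ)
    (g : (Fin n → Bool) → (Fin n → Bool) → ℝ) : ℝ :=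
  ∑ x : Fin n → Bool, ∑ y : Fin n → Bool, wPi n p x * wNoise n ρ x y * g x y

/-- The standard deviation `σᵢ^ρ = √(1 - ρ²μᵢ²)` of the noisy coordinate `Yᵢ`. -/
noncomputable def sigmaRho (n : ℕ) (p : Fin n → ℝ) (ρ : ℝ) (i : Fin n) : ℝ :=
  Real.sqrt (1 - ρ ^ 2 * mu n p i ^ 2)

/-- The standardised noisy coordinate `φ^ρ(yᵢ) = (yᵢ - ρμᵢ)/σᵢ^ρ`. -/
noncomputable def phiRho (n : ℕ) (p : Fin n → ℝ) (ρ : ℝ) (i : Fin n) (y : Fin n → Bool) : ℝ :=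
  (toR (y i) - ρ * mu n p i) / sigmaRho n p ρ i

/-- The basis function `φ^ρ_S(y) = ∏_{i∈S} φ^ρ(yᵢ)` (with `φ^ρ_∅ = 1`). -/
noncomputable def phiRhoS (n : ℕ) (p : Fin n → ℝ) (ρ : ℝ) (S : Finset (Fin n))
    (y : Fin n → Bool) : ℝ :=
  ∏ i ∈ S, phiRho n p ρ i y

/-- The Fourier coefficient `f̂^{π,ρ}(S) = E_{π,ρ}[f(Y) φ^ρ_S(Y)]`. -/
noncomputable def fourierRho (n : ℕ) (p : Fin n → ℝ) (ρ : ℝ) (f : (Fin n → Bool) → ℝ)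
    (S : Finset (Fin n)) : ℝ :=
  jointE n p ρ (fun _ y => f y * phiRhoS n p ρ S y)

/-- The probability that the noisy copy equals `y`. -/
noncomputable def wRho (n : ℕ) (p : Fin n → ℝ) (ρ : ℝ) (y : Fin n → Bool) : ℝ :=
  ∏ i, (1 + ρ * mu n p i * toR (y i)) / 2

lemma sum_wNoise (n : ℕ) (ρ : ℝ) (x : Fin n → Bool) : ∑ y, wNoise n ρ x y = 1 := by
  unfold wNoise
  rw [← Fintype.prod_sum (fun i b => if b = x i then (1 + ρ) / 2 else (1 - ρ) / 2)]
  refine Finset.prod_eq_one fun i _ => ?_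
  cases x i <;> simp <;> ring

lemma sum_wPi_mul_wNoise (n : ℕ) (p : Fin n → ℝ) (ρ : ℝ) (y : Fin n → Bool) :
    ∑ x, wPi n p x * wNoise n ρ x y = wRho n p ρ y := by
  simp only [wPi, wNoise, wRho, ← Finset.prod_mul_distrib]
  rw [← Fintype.prod_sum
    (fun i b => (if b then p i else 1 - p i) * if y i = b then (1 + ρ) / 2 else (1 - ρ) / 2)]
  refine Finset.prod_congr rfl fun i _ => ?_
  cases y i <;> simp [mu, toR] <;> ring

lemma jointE_left (n : ℕ) (p : Fin n → ℝ) (ρ : ℝ) (g : (Fin n → Bool) → ℝ) :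
    jointE n p ρ (fun x _ => g x) = piE n p g := by
  unfold jointE piE
  refine Finset.sum_congr rfl fun x _ => ?_
  rw [← Finset.sum_mul, ← Finset.mul_sum, sum_wNoise, mul_one]

lemma jointE_right (n : ℕ) (p : Fin n → ℝ) (ρ : ℝ) (g : (Fin n → Bool) → ℝ) :
    jointE n p ρ (fun _ y => g y) = ∑ y, wRho n p ρ y * g y := by
  unfold jointE
  rw [Finset.sum_comm]
  refine Finset.sum_congr rfl fun y _ => ?_
  rw [← Finset.sum_mul, sum_wPi_mul_wNoise]

/-- Expansion of the noise kernel in the two product bases. -/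
lemma wNoise_eq_sum (n : ℕ) (p : Fin n → ℝ) (hp : ∀ i, p i ∈ Set.Ioo (0 : ℝ) 1)
    (ρ : ℝ) (hρ : ρ ∈ Set.Ioo (-1 : ℝ) 1) (x y : Fin n → Bool) :
    wNoise n ρ x y = wRho n p ρ y * ∑ S : Finset (Fin n),
      (∏ i ∈ S, sigma n p i / sigmaRho n p ρ i) * ρ ^ S.card * phiS n p S x *
        phiRhoS n p ρ S y := by
  have hS : ∀ S : Finset (Fin n),
      (∏ i ∈ S, sigma n p i / sigmaRho n p ρ i) * ρ ^ S.card * phiS n p S x *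
        phiRhoS n p ρ S y =
      ∏ i ∈ S, sigma n p i / sigmaRho n p ρ i * ρ * phi n p i x * phiRho n p ρ i y := by
    intro S
    simp only [phiS, phiRhoS, ← Finset.prod_const, Finset.prod_mul_distrib]
  simp only [hS]
  rw [← Finset.powerset_univ, ← Finset.prod_one_add, wRho, wNoise, ← Finset.prod_mul_distrib]
  refine Finset.prod_congr rfl fun i _ => ?_
  have hμ : mu n p i ^ 2 < 1 := by
    obtain ⟨h₀, h₁⟩ := hp i
    unfold mu
    nlinarith
  have hρμ : ρ ^ 2 * mu n p i ^ 2 < 1 := by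
    have : ρ ^ 2 < 1 := by nlinarith [hρ.1, hρ.2]
    nlinarith [sq_nonneg (mu n p i), sq_nonneg ρ]
  have hσ : sigma n p i ≠ 0 := (Real.sqrt_pos.2 (by linarith)).ne'
  have hσρ : sigmaRho n p ρ i ≠ 0 := (Real.sqrt_pos.2 (by linarith)).ne'
  have hsq : sigmaRho n p ρ i ^ 2 = 1 - ρ ^ 2 * mu n p i ^ 2 :=
    Real.sq_sqrt (by linarith)
  have hne : 1 - ρ ^ 2 * mu n p i ^ 2 ≠ 0 := by linarith
  have hterm : sigma n p i / sigmaRho n p ρ i * ρ * phi n p i x * phiRho n p ρ i y =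
      ρ * (toR (x i) - mu n p i) * (toR (y i) - ρ * mu n p i) /
        (1 - ρ ^ 2 * mu n p i ^ 2) := by
    rw [← hsq, phi, phiRho]
    field_simp
  rw [hterm]
  cases x i <;> cases y i <;> simp [toR] <;> field_simp <;> ring

/-- Plancherel-type formula for the correlation of a function with its noisy copy. -/
lemma jointE_mul_eq_sum (n : ℕ) (p : Fin n → ℝ) (hp : ∀ i, p i ∈ Set.Ioo (0 : ℝ) 1)
    (ρ : ℝ) (hρ : ρ ∈ Set.Ioo (-1 : ℝ) 1) (f g : (Fin n → Bool) → ℝ) :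
    jointE n p ρ (fun x y => f x * g y) = ∑ S : Finset (Fin n),
      (∏ i ∈ S, sigma n p i / sigmaRho n p ρ i) * ρ ^ S.card *
        fourierPi n p f S * fourierRho n p ρ g S := by
  simp only [fourierRho, jointE_right, fourierPi, piE]
  simp only [jointE, wNoise_eq_sum n p hp ρ hρ, Finset.mul_sum, Finset.sum_mul]
  rw [Finset.sum_comm_cycle]
  refine Finset.sum_congr rfl fun S _ => ?_
  rw [Finset.sum_comm]
  refine Finset.sum_congr rfl fun y _ => Finset.sum_congr rfl fun x _ => ?_
  ring

/-- Covariance of the decision with its noisy copy: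
`Cov_{π,ρ}(f(X), f(Y)) = Σ_{S≠∅} ω(S) ρ^{|S|} f̂^π(S) f̂^{π,ρ}(S)`,
where `ω(S) = ∏_{i∈S} σᵢ/σᵢ^ρ`. -/
theorem noisy_covariance (n : ℕ) (p : Fin n → ℝ) (hp : ∀ i, p i ∈ Set.Ioo (0 : ℝ) 1)
    (ρ : ℝ) (hρ : ρ ∈ Set.Ioo (-1 : ℝ) 1)
    (f : (Fin n → Bool) → ℝ) (hf : ∀ x, f x = 1 ∨ f x = -1) :
    jointE n p ρ (fun x y => f x * f y) -
        jointE n p ρ (fun x _ => f x) * jointE n p ρ (fun _ y => f y) =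
      ∑ S ∈ Finset.univ.filter (fun S : Finset (Fin n) => S ≠ ∅),
        (∏ i ∈ S, sigma n p i / sigmaRho n p ρ i) * ρ ^ S.card *
          fourierPi n p f S * fourierRho n p ρ f S := by
  rw [jointE_mul_eq_sum n p hp ρ hρ, jointE_left, jointE_right, Finset.filter_ne',
    ← Finset.add_sum_erase _ _ (Finset.mem_univ (∅ : Finset (Fin n)))]
  simp [fourierPi, fourierRho, jointE_right, phiS, phiRhoS]
end
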